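/- If li_0(x) ≤ π(x) ≤ li_1(x) for all real x ≥ e, then the Riemann Hypothesis holds (every non-trivial zero of the Riemann zeta function has real part 1/2). -/

import Mathlib

/-- The Stieltjes asymptotic approximation of `li(x)`:
`li_*(x) = (x/log x)·Σ_{k=0}^{n−1} k!/(log x)^k + (log x − n)·x·n!/(log x)^(n+1)`
with `n = ⌊log x⌋`. -/
noncomputable def liStar (x : ℝ) : ℝ :=
  x / Real.log x *
      ∑ k ∈ Finset.range ⌊Real.log x⌋₊, (Nat.factorial k : ℝ) / Real.log x ^ k
    + (Real.log x - ⌊Real.log x⌋₊) * x * (Nat.factorial ⌊Real.log x⌋₊ : ℝ)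
      / Real.log x ^ (⌊Real.log x⌋₊ + 1)

/-- The truncated asymptotic approximation of `li(x)` with truncation parameter `κ`
and fractional coefficient `α`:
`li_{κ,α}(x) = (x/log x)·(α·m!/(log x)^m + Σ_{k=0}^{m−1} k!/(log x)^k)` with
`m = ⌊κ·log x⌋`. -/
noncomputable def liApprox (κ α x : ℝ) : ℝ :=
  x / Real.log x *
    (α * (Nat.factorial ⌊κ * Real.log x⌋₊ : ℝ) / Real.log x ^ ⌊κ * Real.log x⌋₊
      + ∑ k ∈ Finset.range ⌊κ * Real.log x⌋₊, (Nat.factorial k : ℝ) / Real.log x ^ k)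

section RegularizedLi

open Real Set Filter Topology MeasureTheory

/-- The entire part of the exponential integral, `∫₀ᵘ (e^v - 1)/v dv`; it differs from
`li (e^u)` by `γ + log u`. -/
noncomputable def regLi (u : ℝ) : ℝ := ∫ v in (0 : ℝ)..u, dslope exp 0 v

theorem continuous_dslope_exp : Continuous (dslope exp 0) := by
  rw [← continuousOn_univ, continuousOn_dslope univ_mem]
  exact ⟨continuous_exp.continuousOn, differentiableAt_exp⟩

theorem dslope_exp_of_ne {v : ℝ} (hv : v ≠ 0) : dslope exp 0 v = (exp v - 1) / v := by
  simp [dslope_of_ne _ hv, slope_def_field]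

theorem dslope_exp_nonneg {v : ℝ} (hv : 0 ≤ v) : 0 ≤ dslope exp 0 v := by
  rcases hv.eq_or_lt with rfl | hv
  · simp
  · rw [dslope_exp_of_ne hv.ne']
    have := one_le_exp hv.le
    exact div_nonneg (by linarith) hv.le

theorem dslope_exp_le_exp {v : ℝ} (hv : 0 ≤ v) : dslope exp 0 v ≤ exp v := by
  rcases hv.eq_or_lt with rfl | hv
  · simp
  · rw [dslope_exp_of_ne hv.ne', div_le_iff₀ hv]
    have h : exp v * exp (-v) = 1 := by rw [← exp_add]; simp
    nlinarith [add_one_le_exp (-v), exp_pos v]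

theorem hasDerivAt_regLi (u : ℝ) : HasDerivAt regLi (dslope exp 0 u) u :=
  continuous_dslope_exp.integral_hasStrictDerivAt 0 u |>.hasDerivAt

theorem continuous_regLi : Continuous regLi :=
  continuous_iff_continuousAt.2 fun u => (hasDerivAt_regLi u).continuousAt

theorem regLi_nonneg {u : ℝ} (hu : 0 ≤ u) : 0 ≤ regLi u :=
  intervalIntegral.integral_nonneg hu fun _ hv => dslope_exp_nonneg hv.1

theorem regLi_le_exp {u : ℝ} (hu : 0 ≤ u) : regLi u ≤ exp u := by
  have h : regLi u ≤ ∫ v in (0 : ℝ)..u, exp v :=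
    intervalIntegral.integral_mono_on hu (continuous_dslope_exp.intervalIntegrable _ _)
      (continuous_exp.intervalIntegrable _ _) fun v hv => dslope_exp_le_exp hv.1
  rw [integral_exp, exp_zero] at h
  linarith

theorem integrableOn_mul_exp_neg_of_le_exp {f : ℝ → ℝ} (hf : Continuous f)
    (hf0 : ∀ u, 0 ≤ u → 0 ≤ f u) (hfe : ∀ u, 0 ≤ u → f u ≤ exp u) {s : ℝ} (hs : 1 < s) :
    IntegrableOn (fun u => f u * exp (-(s * u))) (Ioi 0) := by
  have hdom : IntegrableOn (fun u => exp (-(s - 1) * u)) (Ioi 0) :=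
    exp_neg_integrableOn_Ioi 0 (sub_pos.2 hs)
  refine Integrable.mono' hdom ?_ ?_
  · exact (hf.mul (by fun_prop)).aestronglyMeasurable
  · filter_upwards [ae_restrict_mem measurableSet_Ioi] with u (hu : 0 < u)
    rw [norm_of_nonneg (mul_nonneg (hf0 u hu.le) (exp_pos _).le),
      show -(s - 1) * u = u + -(s * u) by ring, exp_add]
    gcongr
    exact hfe u hu.le

theorem integral_dslope_exp_mul_exp_neg {s : ℝ} (hs : 1 < s) :
    ∫ u in Ioi 0, dslope exp 0 u * exp (-(s * u)) = log (s / (s - 1)) := by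
  have hcongr : EqOn (fun u => dslope exp 0 u * exp (-(s * u)))
      (fun u => u⁻¹ • ((fun v => exp (-v)) ((s - 1) * u) - (fun v => exp (-v)) (s * u)))
      (Ioi 0) := by
    intro u (hu : 0 < u)
    simp only [dslope_exp_of_ne hu.ne', smul_eq_mul]
    rw [show -((s - 1) * u) = u + -(s * u) by ring, exp_add]
    field_simp
  have hzero : Tendsto (fun v : ℝ => exp (-v)) (𝓝[>] 0) (𝓝 1) := by
    have h : Continuous fun v : ℝ => exp (-v) := by fun_prop
    simpa using (h.tendsto 0).mono_left nhdsWithin_le_nhds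
  have hloc : LocallyIntegrableOn (fun v : ℝ => exp (-v)) (Ioi 0) :=
    (Continuous.locallyIntegrable (by fun_prop)).locallyIntegrableOn _
  rw [setIntegral_congr_fun measurableSet_Ioi hcongr,
    Frullani.integral_Ioi_eq hloc (sub_pos.2 hs) (by linarith) hzero
      tendsto_exp_neg_atTop_nhds_zero
      ((integrableOn_mul_exp_neg_of_le_exp continuous_dslope_exp (fun _ => dslope_exp_nonneg)
        (fun _ => dslope_exp_le_exp) hs).congr_fun hcongr measurableSet_Ioi)]
  simp

theorem integrableOn_regLi_mul_exp_neg {s : ℝ} (hs : 1 < s) :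
    IntegrableOn (fun u => regLi u * exp (-(s * u))) (Ioi 0) :=
  integrableOn_mul_exp_neg_of_le_exp continuous_regLi (fun _ => regLi_nonneg)
    (fun _ => regLi_le_exp) hs

theorem mul_integral_regLi_mul_exp_neg {s : ℝ} (hs : 1 < s) :
    s * ∫ u in Ioi 0, regLi u * exp (-(s * u)) = log (s / (s - 1)) := by
  have hint := integrableOn_regLi_mul_exp_neg hs
  have hint' := integrableOn_mul_exp_neg_of_le_exp continuous_dslope_exp
    (fun _ => dslope_exp_nonneg) (fun _ => dslope_exp_le_exp) hs
  have hderiv : ∀ u ∈ Ici (0 : ℝ), HasDerivAt (fun u => regLi u * exp (-(s * u)))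
      (dslope exp 0 u * exp (-(s * u)) - s * (regLi u * exp (-(s * u)))) u := fun u _ => by
    have h := (hasDerivAt_regLi u).mul (((hasDerivAt_id u).const_mul s).neg.exp)
    convert! h using 1
    simp only [Pi.neg_apply, id]
    ring
  have hlim : Tendsto (fun u => regLi u * exp (-(s * u))) atTop (𝓝 0) := by
    have h : Tendsto (fun u => exp (-((s - 1) * u))) atTop (𝓝 0) :=
      tendsto_exp_neg_atTop_nhds_zero.comp (tendsto_id.const_mul_atTop (sub_pos.2 hs))
    refine squeeze_zero' ?_ ?_ h
    · filter_upwards [eventually_ge_atTop 0] with u hu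
      exact mul_nonneg (regLi_nonneg hu) (exp_pos _).le
    · filter_upwards [eventually_ge_atTop 0] with u hu
      rw [show -((s - 1) * u) = u + -(s * u) by ring, exp_add]
      gcongr
      exact regLi_le_exp hu
  have h := integral_Ioi_of_hasDerivAt_of_tendsto' hderiv (hint'.sub (hint.const_mul s)) hlim
  rw [integral_sub hint' (hint.const_mul s), integral_const_mul,
    integral_dslope_exp_mul_exp_neg hs] at h
  simp only [regLi, intervalIntegral.integral_same, zero_mul, sub_zero] at h ⊢
  linarith

theorem integrableOn_regLi_log_mul_rpow {s : ℝ} (hs : 1 < s) :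
    IntegrableOn (fun t => regLi (log t) * t ^ (-(s + 1))) (Ioi 1) := by
  have h := integrableOn_regLi_mul_exp_neg hs
  rw [← log_one, ← integrableOn_comp_log_Ioi _ one_pos] at h
  refine h.congr_fun (fun t (ht : 1 < t) => ?_) measurableSet_Ioi
  have ht0 : 0 < t := by linarith
  simp only [smul_eq_mul]
  rw [neg_add, rpow_add ht0, rpow_neg_one, rpow_def_of_pos ht0,
    show log t * -s = -(s * log t) by ring]
  ring

theorem mul_integral_regLi_log_mul_rpow {s : ℝ} (hs : 1 < s) :
    s * ∫ t in Ioi 1, regLi (log t) * t ^ (-(s + 1)) = log (s / (s - 1)) := by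
  have h := integral_comp_log_Ioi (fun u => regLi u * exp (-(s * u))) one_pos
  rw [log_one] at h
  rw [← mul_integral_regLi_mul_exp_neg hs, ← h]
  congr 1
  refine setIntegral_congr_fun measurableSet_Ioi fun t (ht : 1 < t) => ?_
  have ht0 : 0 < t := by linarith
  simp only [smul_eq_mul]
  rw [neg_add, rpow_add ht0, rpow_neg_one, rpow_def_of_pos ht0,
    show log t * -s = -(s * log t) by ring]
  ring

end RegularizedLi

section TruncatedLi

open Real Filter Topology

/-- The asymptotic series of `li (e^u)` truncated after `m` terms. -/
noncomputable def truncLi (m : ℕ) (u : ℝ) : ℝ :=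
  exp u / u * ∑ k ∈ Finset.range m, (k.factorial : ℝ) / u ^ k

theorem truncLi_succ (m : ℕ) (u : ℝ) :
    truncLi (m + 1) u = truncLi m u + exp u / u * (m.factorial / u ^ m) := by
  simp [truncLi, Finset.sum_range_succ, mul_add]

theorem liApprox_zero_eq_truncLi (κ : ℝ) {x : ℝ} (hx : 0 < x) :
    liApprox κ 0 x = truncLi ⌊κ * log x⌋₊ (log x) := by
  simp [liApprox, truncLi, exp_log hx]

theorem liApprox_one_eq_truncLi (κ : ℝ) {x : ℝ} (hx : 0 < x) :
    liApprox κ 1 x = truncLi (⌊κ * log x⌋₊ + 1) (log x) := by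
  rw [truncLi_succ, liApprox, truncLi, exp_log hx]
  simp
  ring

theorem hasDerivAt_truncLi (m : ℕ) {u : ℝ} (hu : u ≠ 0) :
    HasDerivAt (truncLi m) (exp u / u - m.factorial * exp u / u ^ (m + 1)) u := by
  induction m with
  | zero =>
    have h : truncLi 0 = fun _ => 0 := by ext; simp [truncLi]
    simpa [h] using hasDerivAt_const u (0 : ℝ)
  | succ m ih =>
    have h : HasDerivAt (fun u => exp u * m.factorial / u ^ (m + 1))
        (m.factorial * exp u / u ^ (m + 1)
          - (m + 1).factorial * exp u / u ^ (m + 1 + 1)) u := by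
      have h := ((hasDerivAt_exp u).mul_const (m.factorial : ℝ)).div
        (hasDerivAt_pow (m + 1) u) (pow_ne_zero _ hu)
      convert! h using 1
      push_cast [Nat.factorial_succ]
      field_simp
      ring
    have hsucc : truncLi (m + 1) = fun u => truncLi m u + exp u * m.factorial / u ^ (m + 1) := by
      ext v
      rw [truncLi_succ, pow_succ']
      field_simp
    rw [hsucc]
    convert! ih.add h using 1
    ring

theorem truncLi_nonneg (m : ℕ) {u : ℝ} (hu : 0 ≤ u) : 0 ≤ truncLi m u := by
  unfold truncLi
  positivity

theorem truncLi_self_le (m : ℕ) : truncLi m m ≤ exp m := by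
  rcases Nat.eq_zero_or_pos m with rfl | hm
  · simp [truncLi]
  have hm' : (0 : ℝ) < m := by exact_mod_cast hm
  have h : ∑ k ∈ Finset.range m, (k.factorial : ℝ) / (m : ℝ) ^ k ≤ m := by
    calc ∑ k ∈ Finset.range m, (k.factorial : ℝ) / (m : ℝ) ^ k
        ≤ ∑ k ∈ Finset.range m, (1 : ℝ) := by
          refine Finset.sum_le_sum fun k hk => div_le_one_of_le₀ ?_ (by positivity)
          have := (Nat.factorial_le_pow k).trans
            (Nat.pow_le_pow_left (Finset.mem_range.1 hk).le k)
          exact_mod_cast this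
      _ = m := by simp
  calc truncLi m m ≤ exp m / m * m := by
        unfold truncLi
        gcongr
    _ = exp m := by field_simp

theorem exp_div_pow_le {m : ℕ} {u v : ℝ} (hu : 0 < u) (hmu : (m : ℝ) ≤ u) (huv : u ≤ v) :
    exp u / u ^ m ≤ exp v / v ^ m := by
  have hv : 0 < v := hu.trans_le huv
  have h : (v / u) ^ m ≤ exp (v - u) := by
    calc (v / u) ^ m ≤ (exp ((v - u) / u)) ^ m := by
          gcongr
          calc v / u = (v - u) / u + 1 := by field_simp; ring
            _ ≤ _ := add_one_le_exp _
      _ = exp (m * ((v - u) / u)) := (exp_nat_mul _ _).symm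
      _ ≤ exp (v - u) := by
          rw [exp_le_exp, mul_div_assoc', div_le_iff₀ hu, mul_comm]
          exact mul_le_mul_of_nonneg_left hmu (sub_nonneg.2 huv)
  rw [exp_sub, div_pow, div_le_div_iff₀ (by positivity) (by positivity)] at h
  rw [div_le_div_iff₀ (by positivity) (by positivity)]
  linarith

theorem abs_regLi_sub_truncLi_le {m : ℕ} {u : ℝ} (hm : 1 ≤ m) (hmu : (m : ℝ) ≤ u) :
    |regLi u - truncLi m u| ≤ exp m + (exp u * (m.factorial / u ^ m) + 1) * (u - m) := by
  have hm1 : (1 : ℝ) ≤ m := by exact_mod_cast hm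
  have hm0 : (0 : ℝ) < m := by linarith
  have hstart : |regLi m - truncLi m m| ≤ exp m := by
    rw [abs_le]
    constructor <;> linarith [regLi_nonneg hm0.le, regLi_le_exp hm0.le,
      truncLi_nonneg m hm0.le, truncLi_self_le m]
  have hderiv : ∀ v ∈ Set.Icc (m : ℝ) u, HasDerivWithinAt (fun v => regLi v - truncLi m v)
      (m.factorial * exp v / v ^ (m + 1) - 1 / v) (Set.Icc (m : ℝ) u) v := fun v hv => by
    have hv0 : v ≠ 0 := (hm0.trans_le hv.1).ne'
    have h := (hasDerivAt_regLi v).sub (hasDerivAt_truncLi m hv0)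
    rw [dslope_exp_of_ne hv0] at h
    convert! h.hasDerivWithinAt using 1
    ring
  have hbound : ∀ v ∈ Set.Icc (m : ℝ) u,
      ‖m.factorial * exp v / v ^ (m + 1) - 1 / v‖ ≤ exp u * (m.factorial / u ^ m) + 1 := by
    intro v hv
    have hv1 : 1 ≤ v := hm1.trans hv.1
    have hv0 : 0 < v := by linarith
    have h1 : m.factorial * exp v / v ^ (m + 1) ≤ exp u * (m.factorial / u ^ m) := by
      calc m.factorial * exp v / v ^ (m + 1) = m.factorial * (exp v / v ^ m) / v := by
            rw [pow_succ]; field_simp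
        _ ≤ m.factorial * (exp v / v ^ m) := div_le_self (by positivity) hv1
        _ ≤ m.factorial * (exp u / u ^ m) := by
            exact mul_le_mul_of_nonneg_left (exp_div_pow_le hv0 hv.1 hv.2) (by positivity)
        _ = _ := by ring
    have h2 : 0 ≤ m.factorial * exp v / v ^ (m + 1) := by positivity
    have h3 : 1 / v ≤ 1 := (div_le_one hv0).2 hv1
    have h4 : 0 ≤ 1 / v := by positivity
    rw [norm_eq_abs, abs_le]
    constructor <;> linarith
  have h := (convex_Icc (m : ℝ) u).norm_image_sub_le_of_norm_hasDerivWithin_le hderiv hbound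
    (Set.left_mem_Icc.2 hmu) (Set.right_mem_Icc.2 hmu)
  rw [norm_eq_abs, norm_eq_abs, abs_of_nonneg (sub_nonneg.2 hmu)] at h
  have := abs_sub_abs_le_abs_sub (regLi u - truncLi m u) (regLi m - truncLi m m)
  linarith

theorem factorial_div_pow_le_add {a k b : ℕ} (hak : a ≤ k) (hkb : k ≤ b) {u : ℝ} (hu : 0 < u) :
    (k.factorial : ℝ) / u ^ k ≤ a.factorial / u ^ a + b.factorial / u ^ b := by
  rcases le_total (k : ℝ) u with hku | hku
  · obtain ⟨c, rfl⟩ := Nat.exists_eq_add_of_le hak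
    have h : ((a + c).factorial : ℝ) ≤ a.factorial * u ^ c := by
      have h := Nat.mul_le_mul_left a.factorial (Nat.ascFactorial_le_pow_add a c)
      rw [Nat.factorial_mul_ascFactorial] at h
      calc ((a + c).factorial : ℝ) ≤ a.factorial * ((a + c : ℕ) : ℝ) ^ c := by exact_mod_cast h
        _ ≤ _ := by gcongr
    have h' : ((a + c).factorial : ℝ) / u ^ (a + c) ≤ a.factorial / u ^ a := by
      rw [div_le_div_iff₀ (by positivity) (by positivity), pow_add]
      nlinarith [mul_le_mul_of_nonneg_right h (pow_nonneg hu.le a)]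
    have : 0 ≤ (b.factorial : ℝ) / u ^ b := by positivity
    linarith
  · obtain ⟨c, rfl⟩ := Nat.exists_eq_add_of_le hkb
    have h : (k.factorial : ℝ) * u ^ c ≤ (k + c).factorial := by
      calc (k.factorial : ℝ) * u ^ c ≤ k.factorial * ((k + 1 : ℕ) : ℝ) ^ c := by
            gcongr
            push_cast
            linarith
        _ ≤ _ := by exact_mod_cast Nat.factorial_mul_pow_le_factorial (m := k) (n := c)
    have h' : (k.factorial : ℝ) / u ^ k ≤ (k + c).factorial / u ^ (k + c) := by
      rw [div_le_div_iff₀ (by positivity) (by positivity), pow_add]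
      nlinarith [mul_le_mul_of_nonneg_right h (pow_nonneg hu.le k)]
    have : 0 ≤ (a.factorial : ℝ) / u ^ a := by positivity
    linarith

theorem truncLi_sub_truncLi_le {a b : ℕ} (hab : a ≤ b + 1) {u : ℝ} (hu : 0 < u) :
    truncLi (b + 1) u - truncLi a u
      ≤ exp u / u * ((b + 1) * (a.factorial / u ^ a + b.factorial / u ^ b)) := by
  have h : truncLi (b + 1) u - truncLi a u
      = exp u / u * ∑ k ∈ Finset.Ico a (b + 1), (k.factorial : ℝ) / u ^ k := by
    rw [truncLi, truncLi, ← mul_sub, Finset.sum_Ico_eq_sub _ hab]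
  rw [h]
  gcongr
  calc ∑ k ∈ Finset.Ico a (b + 1), (k.factorial : ℝ) / u ^ k
      ≤ ∑ k ∈ Finset.Ico a (b + 1), ((a.factorial : ℝ) / u ^ a + b.factorial / u ^ b) := by
        refine Finset.sum_le_sum fun k hk => ?_
        rw [Finset.mem_Ico] at hk
        exact factorial_div_pow_le_add hk.1 (by omega) hu
    _ = ((b + 1 - a : ℕ) : ℝ) * ((a.factorial : ℝ) / u ^ a + b.factorial / u ^ b) := by
        rw [Finset.sum_const, Nat.card_Ico, nsmul_eq_mul]
    _ ≤ _ := by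
        gcongr
        exact_mod_cast Nat.sub_le (b + 1) a

theorem factorial_le_exp_one_mul {m : ℕ} (hm : 1 ≤ m) :
    (m.factorial : ℝ) ≤ exp 1 * m * (m / exp 1) ^ m := by
  obtain ⟨n, rfl⟩ := Nat.exists_eq_add_of_le' hm
  have h : Stirling.stirlingSeq (n + 1) ≤ exp 1 / √2 := by
    rw [← Stirling.stirlingSeq_one]
    exact Stirling.stirlingSeq'_antitone (Nat.zero_le n)
  rw [Stirling.stirlingSeq, div_le_iff₀ (by positivity), sqrt_mul zero_le_two] at h
  have hsqrt : √((n + 1 : ℕ) : ℝ) ≤ (n + 1 : ℕ) :=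
    sqrt_le_iff.2 ⟨by positivity, by exact_mod_cast Nat.le_self_pow two_ne_zero _⟩
  calc ((n + 1).factorial : ℝ)
      ≤ exp 1 / √2 * (√2 * √((n + 1 : ℕ) : ℝ) * (((n + 1 : ℕ) : ℝ) / exp 1) ^ (n + 1)) := h
    _ = exp 1 * √((n + 1 : ℕ) : ℝ) * (((n + 1 : ℕ) : ℝ) / exp 1) ^ (n + 1) := by field_simp
    _ ≤ _ := by gcongr

theorem eventually_factorial_floor_div_pow_le {κ : ℝ} (hκ : 0 < κ)
    (hsol : κ * (1 - log κ) = 1 / 2) {ε : ℝ} (hε : 0 < ε) :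
    ∀ᶠ u : ℝ in atTop,
      (⌊κ * u⌋₊.factorial : ℝ) / u ^ ⌊κ * u⌋₊ ≤ exp ((-1 / 2 + ε) * u) := by
  have hratio : Tendsto (fun u : ℝ => (⌊κ * u⌋₊ : ℝ) / u) atTop (𝓝 κ) :=
    tendsto_nat_floor_mul_div_atTop hκ.le
  have hexponent : ∀ᶠ u : ℝ in atTop,
      (⌊κ * u⌋₊ : ℝ) / u * (log (⌊κ * u⌋₊ / u) - 1) < -1 / 2 + ε / 2 := by
    have h : Tendsto (fun u : ℝ => (⌊κ * u⌋₊ : ℝ) / u * (log (⌊κ * u⌋₊ / u) - 1)) atTop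
        (𝓝 (κ * (log κ - 1))) := hratio.mul ((hratio.log hκ.ne').sub_const 1)
    exact h.eventually_lt_const (by linarith)
  have hlin : ∀ᶠ u : ℝ in atTop, exp 1 * κ * u ≤ exp (ε / 2 * u) := by
    have h := (isLittleO_pow_exp_pos_mul_atTop 1 (half_pos hε)).bound
      (c := (exp 1 * κ)⁻¹) (by positivity)
    filter_upwards [h, eventually_ge_atTop 0] with u hu hu0
    simp only [pow_one, norm_eq_abs, abs_exp, abs_of_nonneg hu0] at hu
    rwa [inv_mul_eq_div, le_div_iff₀' (by positivity)] at hu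
  filter_upwards [hexponent, hlin, eventually_ge_atTop (1 / κ), eventually_gt_atTop 0]
    with u h1 h2 h3 hu
  have hm : 1 ≤ ⌊κ * u⌋₊ := by
    rw [Nat.one_le_floor_iff]
    rwa [div_le_iff₀' hκ] at h3
  have hmle : (⌊κ * u⌋₊ : ℝ) ≤ κ * u := Nat.floor_le (by positivity)
  set m := ⌊κ * u⌋₊
  have hm0 : (0 : ℝ) < m := by exact_mod_cast hm
  have hpow : ((m : ℝ) / exp 1) ^ m / u ^ m = exp (m / u * (log (m / u) - 1) * u) := by
    rw [← div_pow, show (m : ℝ) / u * (log (m / u) - 1) * u = m * (log (m / u) - 1) by field_simp,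
      exp_nat_mul, exp_sub, exp_log (by positivity)]
    congr 1
    field_simp
  calc (m.factorial : ℝ) / u ^ m ≤ exp 1 * m * (m / exp 1) ^ m / u ^ m := by
        gcongr
        exact factorial_le_exp_one_mul hm
    _ = exp 1 * m * exp (m / u * (log (m / u) - 1) * u) := by rw [mul_div_assoc, hpow]
    _ ≤ exp (ε / 2 * u) * exp ((-1 / 2 + ε / 2) * u) := by
        gcongr
        nlinarith [exp_pos 1]
    _ = exp ((-1 / 2 + ε) * u) := by rw [← exp_add]; ring_nf

end TruncatedLi

section Asymptotics

open Real Filter Topology Asymptotics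

theorem sub_regLi_log_isBigO_of_liApprox_bounds {κℓ κᵤ : ℝ} (hκℓ0 : 0 < κℓ) (hκℓ1 : κℓ < 1)
    (hκᵤ1 : 1 < κᵤ) (hκᵤe : κᵤ < exp 1)
    (hsolℓ : κℓ * (1 - log κℓ) = 1 / 2) (hsolᵤ : κᵤ * (1 - log κᵤ) = 1 / 2) {f : ℝ → ℝ}
    (hf : ∀ x : ℝ, exp 1 ≤ x → liApprox κℓ 0 x ≤ f x ∧ f x ≤ liApprox κᵤ 1 x)
    {ε : ℝ} (hε : 0 < ε) :
    (fun x => f x - regLi (log x)) =O[atTop] fun x => x ^ (1 / 2 + ε) := by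
  have hκℓ : κℓ ≤ 1 / 2 := by nlinarith [log_neg hκℓ0 hκℓ1]
  have hκᵤ3 : κᵤ ≤ 3 := by linarith [exp_one_lt_d9]
  have hδ : 0 < ε / 2 := half_pos hε
  refine IsBigO.of_bound (9 + 2 / (ε / 2)) ?_
  filter_upwards [eventually_ge_atTop (exp 1), tendsto_log_atTop.eventually
    ((eventually_factorial_floor_div_pow_le hκℓ0 hsolℓ hδ).and
      ((eventually_factorial_floor_div_pow_le (by linarith) hsolᵤ hδ).and
        ((eventually_ge_atTop (1 / κℓ)).and (eventually_ge_atTop 1))))]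
    with x hx ⟨hTℓ, hTᵤ, huκ, hu1⟩
  have hx0 : 0 < x := (exp_pos 1).trans_le hx
  obtain ⟨hfℓ, hfᵤ⟩ := hf x hx
  rw [liApprox_zero_eq_truncLi _ hx0] at hfℓ
  rw [liApprox_one_eq_truncLi _ hx0] at hfᵤ
  rw [norm_eq_abs, norm_eq_abs, abs_of_nonneg (rpow_nonneg hx0.le _), rpow_def_of_pos hx0]
  set u := log x
  have hu : 0 < u := by linarith
  have hm1 : 1 ≤ ⌊κℓ * u⌋₊ := by
    rw [Nat.one_le_floor_iff]
    rwa [div_le_iff₀' hκℓ0] at huκ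
  have hm : (⌊κℓ * u⌋₊ : ℝ) ≤ 1 / 2 * u :=
    (Nat.floor_le (by positivity)).trans (by gcongr)
  have hM : (⌊κᵤ * u⌋₊ : ℝ) ≤ 3 * u :=
    (Nat.floor_le (by positivity)).trans (by gcongr)
  have hmM : ⌊κℓ * u⌋₊ ≤ ⌊κᵤ * u⌋₊ + 1 :=
    (Nat.floor_le_floor (by gcongr; linarith)).trans (Nat.le_succ _)
  have hlower := abs_regLi_sub_truncLi_le (u := u) hm1 (by linarith)
  have hgap := truncLi_sub_truncLi_le hmM hu
  set m := ⌊κℓ * u⌋₊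
  set M := ⌊κᵤ * u⌋₊
  set E := exp ((1 / 2 + ε / 2) * u) with hE
  have hEmul : exp u * exp ((-1 / 2 + ε / 2) * u) = E := by rw [← exp_add, hE]; ring_nf
  have hE1 : 1 ≤ E := one_le_exp (by positivity)
  have hgap' : exp u / u * ((M + 1) * (m.factorial / u ^ m + M.factorial / u ^ M)) ≤ 8 * E := by
    calc exp u / u * ((M + 1) * (m.factorial / u ^ m + M.factorial / u ^ M))
        ≤ exp u / u * ((4 * u) *
          (exp ((-1 / 2 + ε / 2) * u) + exp ((-1 / 2 + ε / 2) * u))) := by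
          gcongr
          linarith
      _ = 8 * E := by rw [← hEmul]; field_simp; ring
  have hm_exp : exp m ≤ E := exp_le_exp.2 (by nlinarith)
  have hslope : (exp u * (m.factorial / u ^ m) + 1) * (u - m) ≤ (E + E) * u := by
    have h1 : exp u * (m.factorial / u ^ m) ≤ E := by
      rw [← hEmul]
      gcongr
    have h2 : (0 : ℝ) ≤ m := Nat.cast_nonneg m
    gcongr
    · linarith
    · linarith
  have hu_le : u ≤ exp (ε / 2 * u) / (ε / 2) := by
    rw [le_div_iff₀' hδ]
    linarith [add_one_le_exp (ε / 2 * u)]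
  have hfinal : E * exp (ε / 2 * u) = exp (u * (1 / 2 + ε)) := by
    rw [hE, ← exp_add]
    ring_nf
  have habs : |f x - regLi u| ≤ 9 * E + (E + E) * u := by
    rw [abs_le] at hlower ⊢
    constructor <;> linarith
  calc |f x - regLi u| ≤ 9 * E + (E + E) * u := habs
    _ ≤ 9 * (E * exp (ε / 2 * u)) + (E + E) * (exp (ε / 2 * u) / (ε / 2)) := by
        gcongr
        exact le_mul_of_one_le_right (by positivity) (one_le_exp (by positivity))
    _ = (9 + 2 / (ε / 2)) * exp (u * (1 / 2 + ε)) := by rw [← hfinal]; ring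

end Asymptotics

section Zeta

open Complex Set Filter Topology MeasureTheory Asymptotics

theorem Nat.Primes.norm_cpow_neg (p : Nat.Primes) (s : ℂ) :
    ‖(p : ℂ) ^ (-s)‖ = (p : ℝ) ^ (-s.re) := by
  rw [norm_natCast_cpow_of_pos p.prop.pos, neg_re]

theorem Nat.Primes.norm_cpow_neg_le {σ : ℝ} (p : Nat.Primes) {s : ℂ} (hs : σ ≤ s.re) :
    ‖(p : ℂ) ^ (-s)‖ ≤ (p : ℝ) ^ (-σ) := by
  rw [p.norm_cpow_neg]
  exact Real.rpow_le_rpow_of_exponent_le (by exact_mod_cast p.prop.one_le) (by linarith)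

theorem Nat.Primes.norm_cpow_neg_le_three_quarters (p : Nat.Primes) {s : ℂ}
    (hs : 1 / 2 ≤ s.re) : ‖(p : ℂ) ^ (-s)‖ ≤ 3 / 4 := by
  have hp : (2 : ℝ) ≤ p := by exact_mod_cast p.prop.two_le
  calc ‖(p : ℂ) ^ (-s)‖ ≤ (p : ℝ) ^ (-(1 / 2) : ℝ) := p.norm_cpow_neg_le hs
    _ ≤ (2 : ℝ) ^ (-(1 / 2) : ℝ) :=
        Real.rpow_le_rpow_of_nonpos two_pos hp (by norm_num)
    _ = (√2)⁻¹ := by rw [Real.rpow_neg zero_le_two, Real.sqrt_eq_rpow]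
    _ ≤ (4 / 3)⁻¹ := by
        gcongr
        exact Real.le_sqrt_of_sq_le (by norm_num)
    _ = 3 / 4 := by norm_num

/-- The contribution of the higher prime powers to `log ζ`. -/
noncomputable def primePowerTerm (p : Nat.Primes) (s : ℂ) : ℂ :=
  -log (1 - (p : ℂ) ^ (-s)) - (p : ℂ) ^ (-s)

theorem norm_primePowerTerm_le {σ : ℝ} (hσ : 1 / 2 ≤ σ) (p : Nat.Primes) {s : ℂ}
    (hs : σ ≤ s.re) : ‖primePowerTerm p s‖ ≤ 2 * (p : ℝ) ^ (-(2 * σ)) := by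
  have h34 := p.norm_cpow_neg_le_three_quarters (hσ.trans hs)
  have hle := p.norm_cpow_neg_le hs
  have h := norm_log_one_add_sub_self_le (z := -(p : ℂ) ^ (-s)) (by rw [norm_neg]; linarith)
  rw [norm_neg, ← sub_eq_add_neg] at h
  have hp : (0 : ℝ) < p := by exact_mod_cast p.prop.pos
  calc ‖primePowerTerm p s‖ = ‖log (1 - (p : ℂ) ^ (-s)) - -(p : ℂ) ^ (-s)‖ := by
        rw [primePowerTerm, ← norm_neg]; ring_nf
    _ ≤ ‖(p : ℂ) ^ (-s)‖ ^ 2 * (1 - ‖(p : ℂ) ^ (-s)‖)⁻¹ / 2 := h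
    _ ≤ ((p : ℝ) ^ (-σ)) ^ 2 * (1 / 4)⁻¹ / 2 := by
        have h4 : (1 : ℝ) / 4 ≤ 1 - ‖(p : ℂ) ^ (-s)‖ := by linarith
        have h0 : 0 ≤ 1 - ‖(p : ℂ) ^ (-s)‖ := by linarith
        gcongr
    _ = 2 * (p : ℝ) ^ (-(2 * σ)) := by
        rw [← Real.rpow_natCast, ← Real.rpow_mul hp.le]
        norm_num
        ring_nf

theorem summable_two_mul_primes_rpow {σ : ℝ} (hσ : 1 / 2 < σ) :
    Summable fun p : Nat.Primes => 2 * (p : ℝ) ^ (-(2 * σ)) :=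
  (Nat.Primes.summable_rpow.2 (by linarith)).mul_left 2

theorem differentiableOn_tsum_primePowerTerm {σ : ℝ} (hσ : 1 / 2 < σ) :
    DifferentiableOn ℂ (fun s => ∑' p, primePowerTerm p s) {s | σ < s.re} := by
  refine differentiableOn_tsum_of_summable_norm (summable_two_mul_primes_rpow hσ) (fun p => ?_)
    (isOpen_lt continuous_const continuous_re)
    (fun p s (hs : σ < s.re) => norm_primePowerTerm_le hσ.le p hs.le)
  intro s (hs : σ < s.re)
  have hp : (p : ℂ) ≠ 0 := by exact_mod_cast p.prop.ne_zero
  have hpow : DifferentiableAt ℂ (fun s => (p : ℂ) ^ (-s)) s :=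
    differentiableAt_id.neg.const_cpow (Or.inl hp)
  have hslit : 1 - (p : ℂ) ^ (-s) ∈ slitPlane := by
    rw [sub_eq_add_neg]
    refine mem_slitPlane_of_norm_lt_one ?_
    rw [norm_neg]
    linarith [p.norm_cpow_neg_le_three_quarters (hσ.le.trans hs.le)]
  exact (((hpow.const_sub 1).clog hslit).neg.sub hpow).differentiableWithinAt

theorem summable_primes_cpow_neg {s : ℂ} (hs : 1 < s.re) :
    Summable fun p : Nat.Primes => (p : ℂ) ^ (-s) :=
  Summable.of_norm_bounded (Nat.Primes.summable_rpow.2 (neg_lt_neg hs))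
    fun p => (p.norm_cpow_neg s).le

theorem riemannZeta_eq_exp_tsum_primes {s : ℂ} (hs : 1 < s.re) :
    riemannZeta s = exp (∑' p, primePowerTerm p s + ∑' p : Nat.Primes, (p : ℂ) ^ (-s)) := by
  have hsum : Summable fun p => primePowerTerm p s :=
    Summable.of_norm_bounded (summable_two_mul_primes_rpow (σ := 1) (by norm_num))
      fun p => norm_primePowerTerm_le (by norm_num) p hs.le
  rw [← riemannZeta_eulerProduct_exp_log hs, ← hsum.tsum_add (summable_primes_cpow_neg hs)]
  simp [primePowerTerm]

theorem tsum_primes_cpow_neg_eq_mul_integral {s : ℂ} (hs : 1 < s.re) :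
    ∑' p : Nat.Primes, (p : ℂ) ^ (-s)
      = s * ∫ t in Ioi (1 : ℝ), (Nat.primeCounting ⌊t⌋₊ : ℂ) * (t : ℂ) ^ (-(s + 1)) := by
  have hcount (n : ℕ) : ∑ k ∈ Finset.Icc 1 n, (if k.Prime then (1 : ℝ) else 0)
      = Nat.primeCounting n := by
    rw [← Nat.primesLE_card_eq_primeCounting, Nat.primesLE_eq_filter_Icc_one, Finset.sum_boole]
  have hcount' (n : ℕ) : ∑ k ∈ Finset.Icc 1 n, (((if k.Prime then 1 else 0 : ℝ)) : ℂ)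
      = Nat.primeCounting n := by
    rw [← ofReal_sum, hcount, ofReal_natCast]
  have hO : (fun n : ℕ => ∑ k ∈ Finset.Icc 1 n, (if k.Prime then (1 : ℝ) else 0))
      =O[atTop] fun n : ℕ => (n : ℝ) ^ (1 : ℝ) := by
    refine isBigO_of_le _ fun n => ?_
    rw [hcount, Real.rpow_one, Real.norm_natCast, Real.norm_natCast,
      ← Nat.primesLE_card_eq_primeCounting, Nat.primesLE_eq_filter_Icc_one]
    exact_mod_cast (Finset.card_filter_le _ _).trans (by simp)
  have h := LSeries_eq_mul_integral_of_nonneg (fun k => if k.Prime then (1 : ℝ) else 0)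
    zero_le_one hs hO fun n => by positivity
  simp only [hcount'] at h
  rw [← h, LSeries]
  change ∑' p : {n : ℕ | n.Prime}, (((p : ℕ) : ℂ)) ^ (-s) = _
  rw [tsum_subtype {n : ℕ | n.Prime} fun n : ℕ => (n : ℂ) ^ (-s)]
  refine tsum_congr fun n => ?_
  by_cases hn : n.Prime
  · simp [hn, hn.ne_zero, LSeries.term, cpow_neg]
  · simp [hn, LSeries.term]

/-- The error `π(t) - ∫₁ᵗ (1 - 1/v)/log v dv`, extended by zero to `t < 1`. -/
noncomputable def primeError (t : ℝ) : ℂ :=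
  ((Nat.primeCounting ⌊t⌋₊ - regLi (Real.log (max t 1)) : ℝ) : ℂ)

theorem primeError_of_le_one {t : ℝ} (ht : t ≤ 1) : primeError t = 0 := by
  have h : Nat.primeCounting ⌊t⌋₊ = 0 :=
    Nat.primeCounting_eq_zero_iff.2 (Nat.floor_le_one_of_le_one ht)
  simp [primeError, h, max_eq_right ht, regLi]

theorem primeError_of_one_le {t : ℝ} (ht : 1 ≤ t) :
    primeError t = Nat.primeCounting ⌊t⌋₊ - (regLi (Real.log t) : ℂ) := by
  simp [primeError, max_eq_left ht]

theorem locallyIntegrable_primeError : LocallyIntegrable primeError := by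
  have h1 : LocallyIntegrable fun t : ℝ => (Nat.primeCounting ⌊t⌋₊ : ℝ) :=
    Monotone.locallyIntegrable fun a b hab => by
      exact_mod_cast Nat.monotone_primeCounting (Nat.floor_le_floor hab)
  have h2 : Continuous fun t : ℝ => regLi (Real.log (max t 1)) :=
    continuous_regLi.comp <| (continuous_id.max continuous_const).log fun t =>
      (zero_lt_one.trans_le (le_max_right t 1)).ne'
  intro t
  obtain ⟨w, hw, hint⟩ := (h1.sub h2.locallyIntegrable) t
  exact ⟨w, hw, hint.ofReal⟩

theorem primeError_isBigO {σ : ℝ}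
    (h : (fun t : ℝ => (Nat.primeCounting ⌊t⌋₊ : ℝ) - regLi (Real.log t))
      =O[atTop] fun t => t ^ σ) :
    primeError =O[atTop] fun t => t ^ (-(-σ)) := by
  rw [neg_neg]
  refine IsBigO.congr' (f₁ := fun t : ℝ =>
    (((Nat.primeCounting ⌊t⌋₊ : ℝ) - regLi (Real.log t) : ℝ) : ℂ)) ?_ ?_ EventuallyEq.rfl
  · exact (isBigO_ofReal_left).2 h
  · filter_upwards [eventually_ge_atTop 1] with t ht
    simp [primeError_of_one_le ht]

theorem primeError_isBigO_zero (b : ℝ) : primeError =O[𝓝[>] 0] fun t => t ^ (-b) := by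
  refine IsBigO.congr' (isBigO_zero (E' := ℂ) _ _) ?_ EventuallyEq.rfl
  filter_upwards [nhdsWithin_le_nhds (Iic_mem_nhds one_pos)] with t ht
  exact (primeError_of_le_one ht).symm

theorem mellinConvergent_primeError {σ : ℝ}
    (h : (fun t : ℝ => (Nat.primeCounting ⌊t⌋₊ : ℝ) - regLi (Real.log t)) =O[atTop] fun t => t ^ σ)
    {s : ℂ} (hs : σ < s.re) :
    MellinConvergent primeError (-s) :=
  mellinConvergent_of_isBigO_rpow (locallyIntegrable_primeError.locallyIntegrableOn _)
    (primeError_isBigO h) (by simpa using hs) (primeError_isBigO_zero (-s.re - 1)) (by simp)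

theorem differentiableAt_mellin_primeError {σ : ℝ}
    (h : (fun t : ℝ => (Nat.primeCounting ⌊t⌋₊ : ℝ) - regLi (Real.log t)) =O[atTop] fun t => t ^ σ)
    {s : ℂ} (hs : σ < s.re) :
    DifferentiableAt ℂ (fun s => mellin primeError (-s)) s := by
  have hd : DifferentiableAt ℂ (mellin primeError) (-s) :=
    mellin_differentiableAt_of_isBigO_rpow (locallyIntegrable_primeError.locallyIntegrableOn _)
      (primeError_isBigO h) (by simpa using hs) (primeError_isBigO_zero (-s.re - 1)) (by simp)
  exact hd.comp s differentiableAt_id.neg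

theorem mul_integral_primeCounting_eq {σ : ℝ}
    (h : (fun t : ℝ => (Nat.primeCounting ⌊t⌋₊ : ℝ) - regLi (Real.log t)) =O[atTop] fun t => t ^ σ)
    {x : ℝ} (hx : 1 < x) (hσx : σ < x) :
    (x : ℂ) * ∫ t in Ioi (1 : ℝ), (Nat.primeCounting ⌊t⌋₊ : ℂ) * (t : ℂ) ^ (-((x : ℂ) + 1))
      = x * mellin primeError (-x) + (Real.log (x / (x - 1)) : ℂ) := by
  have hreal : ∀ t ∈ Ioi (1 : ℝ), ((regLi (Real.log t) * t ^ (-(x + 1)) : ℝ) : ℂ)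
      = regLi (Real.log t) * (t : ℂ) ^ (-((x : ℂ) + 1)) := fun t (ht : 1 < t) => by
    rw [ofReal_mul, ofReal_cpow (by linarith)]
    push_cast
    rfl
  have hint : IntegrableOn (fun t : ℝ => (t : ℂ) ^ (-(x : ℂ) - 1) • primeError t) (Ioi 1) :=
    (mellinConvergent_primeError h (s := x) (by simpa using hσx)).mono_set
      (Ioi_subset_Ioi zero_le_one)
  have hintLi : IntegrableOn
      (fun t : ℝ => ((regLi (Real.log t) * t ^ (-(x + 1)) : ℝ) : ℂ)) (Ioi 1) :=
    (integrableOn_regLi_log_mul_rpow hx).ofReal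
  have hmellin : mellin primeError (-x)
      = ∫ t in Ioi (1 : ℝ), (t : ℂ) ^ (-(x : ℂ) - 1) • primeError t := by
    refine setIntegral_eq_of_subset_of_forall_sdiff_eq_zero measurableSet_Ioi
      (Ioi_subset_Ioi zero_le_one) fun t ht => ?_
    rw [primeError_of_le_one (not_lt.1 ht.2), smul_zero]
  rw [hmellin, ← mul_integral_regLi_log_mul_rpow hx, ofReal_mul, ← integral_complex_ofReal,
    ← mul_add, ← integral_add hint hintLi]
  congr 1
  refine setIntegral_congr_fun measurableSet_Ioi fun t ht => ?_
  rw [smul_eq_mul, hreal t ht, primeError_of_one_le (le_of_lt ht), neg_add, ← sub_eq_add_neg]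
  ring

theorem sub_one_mul_riemannZeta_ofReal {σ : ℝ}
    (h : (fun t : ℝ => (Nat.primeCounting ⌊t⌋₊ : ℝ) - regLi (Real.log t)) =O[atTop] fun t => t ^ σ)
    {x : ℝ} (hx : 1 < x) (hσx : σ < x) :
    ((x : ℂ) - 1) * riemannZeta x
      = x * exp (∑' p, primePowerTerm p x + x * mellin primeError (-x)) := by
  have hx' : 1 < (x : ℂ).re := by simpa using hx
  have hx1 : (x : ℂ) - 1 ≠ 0 := sub_ne_zero.2 (by exact_mod_cast hx.ne')
  have hpos : 0 < x / (x - 1) := div_pos (by linarith) (by linarith)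
  rw [riemannZeta_eq_exp_tsum_primes hx', tsum_primes_cpow_neg_eq_mul_integral hx',
    mul_integral_primeCounting_eq h hx hσx, ← add_assoc, exp_add _ (Real.log _ : ℂ), ← ofReal_exp,
    Real.exp_log hpos]
  push_cast
  field_simp

theorem riemannZeta_ne_zero_of_primeCounting_isBigO {σ : ℝ}
    (h : (fun t : ℝ => (Nat.primeCounting ⌊t⌋₊ : ℝ) - regLi (Real.log t)) =O[atTop] fun t => t ^ σ)
    (hσ : 1 / 2 < σ) {s : ℂ} (hs : σ < s.re) :
    riemannZeta s ≠ 0 := by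
  rcases eq_or_ne s 1 with rfl | hs1
  · exact riemannZeta_ne_zero_of_one_le_re le_rfl
  set U : Set ℂ := {s | σ < s.re}
  have hU : IsOpen U := isOpen_lt continuous_const continuous_re
  have hne : ∀ z ∈ U, z ≠ 0 := fun z (hz : σ < z.re) hz0 => by
    rw [hz0, zero_re] at hz
    linarith
  set Z : ℂ → ℂ := fun s => ((s - 1) * completedRiemannZeta₀ s - (s - 1) / s + 1) * (Gammaℝ s)⁻¹
  set R : ℂ → ℂ := fun s => s * exp (∑' p, primePowerTerm p s + s * mellin primeError (-s))
  have hZ : ∀ z, z ≠ 0 → z ≠ 1 → Z z = (z - 1) * riemannZeta z := fun z hz0 hz1 => by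
    have h1 : 1 - z ≠ 0 := sub_ne_zero.2 hz1.symm
    simp only [Z]
    rw [riemannZeta_def_of_ne_zero hz0, completedRiemannZeta_eq, ← div_eq_mul_inv, mul_div_assoc']
    congr 1
    field_simp
    ring
  have hZd : DifferentiableOn ℂ Z U := fun z hz => by
    have hid : DifferentiableAt ℂ (fun z : ℂ => z - 1) z := by fun_prop
    have hd : DifferentiableAt ℂ Z z :=
      (((hid.mul differentiable_completedZeta₀.differentiableAt).sub
        (hid.div differentiableAt_id (hne z hz))).add_const 1).mul
          differentiable_Gammaℝ_inv.differentiableAt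
    exact hd.differentiableWithinAt
  have hRd : DifferentiableOn ℂ R U :=
    differentiableOn_id.mul (((differentiableOn_tsum_primePowerTerm hσ).add
      (differentiableOn_id.mul fun z hz =>
        (differentiableAt_mellin_primeError h hz).differentiableWithinAt)).cexp)
  set a : ℝ := max σ 1 + 1
  have haσ : σ < a := by linarith [le_max_left σ 1]
  have ha1 : 1 < a := by linarith [le_max_right σ 1]
  have hfreq : ∃ᶠ z in 𝓝[≠] (a : ℂ), Z z = R z := by
    have ht : Tendsto ((↑) : ℝ → ℂ) (𝓝[>] a) (𝓝[≠] (a : ℂ)) :=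
      tendsto_nhdsWithin_of_tendsto_nhds_of_eventually_within _
        (continuous_ofReal.continuousAt.mono_left nhdsWithin_le_nhds)
        (eventually_mem_nhdsWithin.mono fun x (hx : a < x) => by
          simpa using hx.ne')
    refine ht.frequently (Eventually.frequently ?_)
    filter_upwards [eventually_mem_nhdsWithin] with x (hx : a < x)
    rw [hZ x (by exact_mod_cast (by linarith : (0 : ℝ) < x).ne')
      (by exact_mod_cast (ha1.trans hx).ne')]
    exact sub_one_mul_riemannZeta_ofReal h (ha1.trans hx) (haσ.trans hx)
  have heq := (hZd.analyticOnNhd hU).eqOn_of_preconnected_of_frequently_eq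
    (hRd.analyticOnNhd hU) (convex_halfSpace_re_gt σ).isPreconnected
    (show (a : ℂ) ∈ U by simpa [U] using haσ) hfreq hs
  intro hzero
  rw [hZ s (hne s hs) hs1, hzero, mul_zero] at heq
  exact mul_ne_zero (hne s hs) (exp_ne_zero _) heq.symm

theorem riemannHypothesis_of_forall_ne_zero
    (h : ∀ s : ℂ, 1 / 2 < s.re → riemannZeta s ≠ 0) : RiemannHypothesis := by
  intro s hs htriv _
  rcases lt_trichotomy s.re (1 / 2) with hlt | heq | hgt
  · have hs0 : s ≠ 0 := by
      rintro rfl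
      norm_num [riemannZeta_zero] at hs
    have hs1 : 1 - s ≠ 0 := fun h0 => by
      rw [← sub_eq_zero.1 h0] at hlt
      norm_num at hlt
    have hGamma : Gammaℝ s ≠ 0 := by
      rw [Ne, Gammaℝ_eq_zero_iff]
      rintro ⟨n, rfl⟩
      rcases n with _ | n
      · simp at hs0
      · exact htriv ⟨n, by push_cast; ring⟩
    rw [riemannZeta_def_of_ne_zero hs0, div_eq_zero_iff, or_iff_left hGamma] at hs
    refine absurd ?_ (h (1 - s) (by rw [sub_re, one_re]; linarith))
    rw [riemannZeta_def_of_ne_zero hs1, completedRiemannZeta_one_sub, hs, zero_div]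
  · exact heq
  · exact absurd hs (h s hgt)

end Zeta

/-- If `li₀(x) ≤ π(x) ≤ li₁(x)` for all real `x ≥ e`, then the
Riemann Hypothesis holds. Here `κ̲ ∈ (0,1)` and `κ̄ ∈ (1,e)` are the two solutions of
`κ(1−log κ) = 1/2`, `li₀(x) = li_{κ̲,0}(x)`, `li₁(x) = li_{κ̄,1}(x)`, and `π` is the
prime counting function. -/
theorem riemannHypothesis_of_conjecture (κℓ κᵤ : ℝ) (hκℓ0 : 0 < κℓ) (hκℓ1 : κℓ < 1)
    (hκᵤ1 : 1 < κᵤ) (hκᵤe : κᵤ < Real.exp 1)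
    (hsolℓ : κℓ * (1 - Real.log κℓ) = 1 / 2) (hsolᵤ : κᵤ * (1 - Real.log κᵤ) = 1 / 2)
    (hconj : ∀ x : ℝ, Real.exp 1 ≤ x →
      liApprox κℓ 0 x ≤ (Nat.primeCounting ⌊x⌋₊ : ℝ) ∧
        (Nat.primeCounting ⌊x⌋₊ : ℝ) ≤ liApprox κᵤ 1 x) :
    RiemannHypothesis := by
  refine riemannHypothesis_of_forall_ne_zero fun s hs => ?_
  have hε : 0 < (s.re - 1 / 2) / 2 := by linarith
  exact riemannZeta_ne_zero_of_primeCounting_isBigO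
    (sub_regLi_log_isBigO_of_liApprox_bounds hκℓ0 hκℓ1 hκᵤ1 hκᵤe hsolℓ hsolᵤ hconj hε)
    (by linarith) (by linarith)
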